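/- Let s₁ < 1, s₂ < 1 and s₁ + s₂ > 0. There exists C = C(s₁, s₂) > 0 such that for all f ∈ Ḣ^{s₁}(ℝ²) and g ∈ Ḣ^{s₂}(ℝ²), the product fg lies in Ḣ^{s₁+s₂−1}(ℝ²) and ‖fg‖_{Ḣ^{s₁+s₂−1}} ≤ C ‖f‖_{Ḣ^{s₁}} ‖g‖_{Ḣ^{s₂}}. -/

import Mathlib

open MeasureTheory
open scoped FourierTransform

/-- The homogeneous Sobolev norm `‖f‖_{Ḣ^σ} = (∫ |ξ|^{2σ} |f̂(ξ)|² dξ)^{1/2}` on `ℝ²`. -/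
noncomputable def homSobolevNorm (σ : ℝ) (f : EuclideanSpace ℝ (Fin 2) → ℂ) : ℝ :=
  (∫ ξ : EuclideanSpace ℝ (Fin 2), ‖ξ‖ ^ (2 * σ) * ‖𝓕 f ξ‖ ^ 2) ^ (1 / 2 : ℝ)

namespace ProductLaw
open scoped ENNReal

/-- The frequency plane. -/
abbrev E2 := EuclideanSpace ℝ (Fin 2)

/-- The power weight `|ξ|^p` with values in `[0,∞]`. -/
noncomputable def wt (p : ℝ) (ξ : E2) : ℝ≥0∞ := ENNReal.ofReal (‖ξ‖ ^ p)

lemma measurable_wt (p : ℝ) : Measurable (wt p) := by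
  unfold wt
  exact (measurable_norm.pow_const p).ennreal_ofReal

lemma wt_mul (p q : ℝ) {ξ : E2} (h : ξ ≠ 0) : wt p ξ * wt q ξ = wt (p + q) ξ := by
  have : 0 < ‖ξ‖ := norm_pos_iff.2 h
  rw [wt, wt, wt, ← ENNReal.ofReal_mul (by positivity), Real.rpow_add this]

lemma wt_sq (p : ℝ) (ξ : E2) : wt p ξ ^ 2 = wt (2 * p) ξ := by
  rw [wt, wt, ← ENNReal.ofReal_pow (by positivity), mul_comm,
    ← Real.rpow_natCast, ← Real.rpow_mul (norm_nonneg _)]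
  norm_num

lemma wt_zero {ξ : E2} : wt 0 ξ = 1 := by simp [wt]

lemma wt_cancel (p : ℝ) {ξ : E2} (h : ξ ≠ 0) : wt (-p) ξ * wt p ξ = 1 := by
  rw [wt_mul _ _ h]; simp [wt_zero]

lemma integrableOn_aux {p : ℝ} (hp : -2 < p) {R : ℝ} (hR : 0 < R) :
    IntegrableOn (fun y : ℝ => y * (Set.Iic R).indicator (fun y => y ^ p) y) (Set.Ioi 0) := by
  have h : IntegrableOn (fun y : ℝ => y ^ (p + 1)) (Set.Ioc 0 R) :=
    (intervalIntegrable_iff_integrableOn_Ioc_of_le hR.le).1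
      (intervalIntegral.intervalIntegrable_rpow' (by linarith))
  have h2 : IntegrableOn ((Set.Ioc 0 R).indicator (fun y : ℝ => y ^ (p + 1))) (Set.Ioi 0) :=
    ((integrable_indicator_iff measurableSet_Ioc).2 h).integrableOn
  refine h2.congr_fun ?_ measurableSet_Ioi
  intro y hy
  have hy' : (0:ℝ) < y := hy
  by_cases hyR : y ≤ R
  · simp [Set.indicator, hyR, hy', Real.rpow_add hy', mul_comm]
  · simp [Set.indicator, hyR]

lemma ball_real {p : ℝ} (hp : -2 < p) {R : ℝ} (hR : 0 < R) :
    Integrable (fun x : E2 => (Set.Iic R).indicator (fun y => y ^ p) ‖x‖) ∧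
    ∫ x : E2, (Set.Iic R).indicator (fun y => y ^ p) ‖x‖ =
      (2 * volume.real (Metric.ball (0 : E2) 1) / (p + 2)) * R ^ (p + 2) := by
  constructor
  · rw [integrable_fun_norm_addHaar volume (f := (Set.Iic R).indicator (fun y => y ^ p))]
    simpa using integrableOn_aux hp hR
  · rw [integral_fun_norm_addHaar volume ((Set.Iic R).indicator (fun y => y ^ p))]
    have : ∫ y in Set.Ioi (0:ℝ), y * (Set.Iic R).indicator (fun y => y ^ p) y
        = R ^ (p + 2) / (p + 2) := by
      have e : ∫ y in Set.Ioi (0:ℝ), y * (Set.Iic R).indicator (fun y => y ^ p) y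
         = ∫ y in Set.Ioi (0:ℝ), (Set.Iic R).indicator (fun y : ℝ => y ^ (p + 1)) y := by
        refine setIntegral_congr_fun measurableSet_Ioi ?_
        intro y hy
        have hy' : (0:ℝ) < y := hy
        by_cases hyR : y ≤ R
        · simp [Set.indicator, hyR, Real.rpow_add hy', mul_comm]
        · simp [Set.indicator, hyR]
      rw [e, setIntegral_indicator measurableSet_Iic, Set.Ioi_inter_Iic,
        ← intervalIntegral.integral_of_le hR.le, integral_rpow (Or.inl (by linarith)),
        Real.zero_rpow (by linarith)]
      ring_nf
    simp only [finrank_euclideanSpace, Fintype.card_fin, smul_eq_mul, nsmul_eq_mul]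
    simp only [show 2 - 1 = 1 from rfl, pow_one, this]
    push_cast
    ring

/-- Integral of a power weight over a ball. -/
lemma ball_lintegral {p : ℝ} (hp : -2 < p) : ∃ M : ℝ≥0∞, M ≠ ∞ ∧ ∀ R : ℝ, 0 < R →
    ∫⁻ x : E2, (if ‖x‖ ≤ R then wt p x else 0) ≤ M * ENNReal.ofReal (R ^ (p + 2)) := by
  refine ⟨ENNReal.ofReal (2 * volume.real (Metric.ball (0 : E2) 1) / (p + 2)),
    ENNReal.ofReal_ne_top, fun R hR => ?_⟩
  obtain ⟨hi, he⟩ := ball_real hp hR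
  have hpp : 0 < p + 2 := by linarith
  rw [← ENNReal.ofReal_mul (by positivity), ← he,
    ofReal_integral_eq_lintegral_ofReal hi
      (ae_of_all _ fun x => by
        by_cases h : ‖x‖ ≤ R <;> simp [Set.indicator, h]; positivity)]
  refine lintegral_mono fun x => ?_
  by_cases h : ‖x‖ ≤ R <;> simp [Set.indicator, h, wt]

lemma cauchy_schwarz {f g : E2 → ℝ≥0∞} (hf : AEMeasurable f) (hg : AEMeasurable g) :
    (∫⁻ x, f x * g x) ^ 2 ≤ (∫⁻ x, f x ^ 2) * ∫⁻ x, g x ^ 2 := by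
  have h := ENNReal.lintegral_mul_le_Lp_mul_Lq volume
    (Real.HolderConjugate.two_two) hf hg
  calc (∫⁻ x, f x * g x) ^ 2 ≤ ((∫⁻ x, f x ^ (2:ℝ)) ^ (1/2:ℝ) * (∫⁻ x, g x ^ (2:ℝ)) ^ (1/2:ℝ)) ^ 2 := by
        gcongr; exact h
    _ = _ := by
        rw [mul_pow, ← ENNReal.rpow_natCast, ← ENNReal.rpow_natCast, ← ENNReal.rpow_mul,
          ← ENNReal.rpow_mul]
        norm_num

/-- `∫∫ a(η)² b(ξ-η)² = ∫ a² ∫ b²`. -/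
lemma lintegral_conv {a b : E2 → ℝ≥0∞} (ha : Measurable a) (hb : Measurable b) :
    ∫⁻ ξ, ∫⁻ η, a η * b (ξ - η) = (∫⁻ η, a η) * ∫⁻ ζ, b ζ := by
  rw [lintegral_lintegral_swap (by fun_prop)]
  have : ∀ η, ∫⁻ ξ, a η * b (ξ - η) = a η * ∫⁻ ζ, b ζ := fun η => by
    rw [lintegral_const_mul _ (by fun_prop), lintegral_sub_right_eq_self b η]
  simp_rw [this]
  rw [lintegral_mul_const _ ha]

lemma ae_ne (c : E2) : ∀ᵐ x : E2, x ≠ c := by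
  simp [ae_iff]

noncomputable def kA (s : ℝ) (ξ η : E2) : ℝ≥0∞ :=
  if ‖η‖ ≤ ‖ξ‖ then wt (s - 1) ξ * wt (-s) η else 0

noncomputable def kB (σ : ℝ) (ξ η : E2) : ℝ≥0∞ :=
  if ‖ξ‖ ≤ ‖η‖ then wt σ ξ * wt (-σ - 1) η else 0

lemma measurable_kA (s : ℝ) : Measurable (fun z : E2 × E2 => kA s z.1 z.2) := by
  unfold kA
  have := measurable_wt (s-1)
  have := measurable_wt (-s)
  exact Measurable.ite (measurableSet_le (by fun_prop) (by fun_prop)) (by fun_prop) (by fun_prop)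

lemma measurable_kB (s : ℝ) : Measurable (fun z : E2 × E2 => kB s z.1 z.2) := by
  unfold kB
  have := measurable_wt s
  have := measurable_wt (-s-1)
  exact Measurable.ite (measurableSet_le (by fun_prop) (by fun_prop)) (by fun_prop) (by fun_prop)

lemma measurable_kA_right (s : ℝ) (ξ : E2) : Measurable (kA s ξ) := by
  unfold kA
  exact Measurable.ite (measurableSet_le measurable_norm measurable_const)
    ((measurable_wt _).const_mul _) measurable_const

lemma measurable_kB_right (s : ℝ) (ξ : E2) : Measurable (kB s ξ) := by
  unfold kB
  exact Measurable.ite (measurableSet_le measurable_const measurable_norm)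
    ((measurable_wt _).const_mul _) measurable_const

lemma boundA {s : ℝ} (hs : s < 1) : ∃ M : ℝ≥0∞, M ≠ ∞ ∧ ∀ a b : E2 → ℝ≥0∞, Measurable a →
    Measurable b → ∫⁻ ξ, (∫⁻ η, kA s ξ η * (a η * b (ξ - η))) ^ 2 ≤
      M * ((∫⁻ η, a η ^ 2) * ∫⁻ ζ, b ζ ^ 2) := by
  obtain ⟨M, hM, h⟩ := ball_lintegral (p := 2 * (-s)) (by linarith)
  refine ⟨M, hM, fun a b ha hb => ?_⟩
  have key : ∀ᵐ ξ : E2, (∫⁻ η, kA s ξ η * (a η * b (ξ - η))) ^ 2 ≤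
      M * ∫⁻ η, a η ^ 2 * b (ξ - η) ^ 2 := by
    filter_upwards [ae_ne 0] with ξ hξ
    have hx : 0 < ‖ξ‖ := norm_pos_iff.2 hξ
    refine (cauchy_schwarz ?_ (by fun_prop)).trans ?_
    · exact (measurable_kA_right s ξ).aemeasurable
    simp_rw [mul_pow]
    gcongr
    calc ∫⁻ x, kA s ξ x ^ 2 = ∫⁻ x, wt (2 * (s - 1)) ξ * (if ‖x‖ ≤ ‖ξ‖ then wt (2 * (-s)) x else 0) := by
          refine lintegral_congr fun x => ?_
          unfold kA
          split_ifs
          · rw [mul_pow, wt_sq, wt_sq]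
          · simp
      _ = wt (2 * (s - 1)) ξ * ∫⁻ x, (if ‖x‖ ≤ ‖ξ‖ then wt (2 * (-s)) x else 0) := by
          rw [lintegral_const_mul]
          exact Measurable.ite (measurableSet_le (by fun_prop) (by fun_prop))
            (measurable_wt _) (by fun_prop)
      _ ≤ wt (2 * (s - 1)) ξ * (M * wt (2 * (-s) + 2) ξ) := by
          gcongr; exact h _ hx
      _ = M := by
          rw [mul_left_comm, wt_mul _ _ hξ]
          ring_nf; simp [wt_zero]
  refine (lintegral_mono_ae key).trans ?_
  rw [lintegral_const_mul' _ _ hM, lintegral_conv (a := fun η => a η ^ 2) (b := fun η => b η ^ 2)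
    (by fun_prop) (by fun_prop)]

lemma boundB {σ : ℝ} (hs : -1 < σ) : ∃ M : ℝ≥0∞, M ≠ ∞ ∧ ∀ a b : E2 → ℝ≥0∞, Measurable a →
    Measurable b → ∫⁻ ξ, (∫⁻ η, kB σ ξ η * (a η * b (ξ - η))) ^ 2 ≤
      M * ((∫⁻ η, a η ^ 2) * ∫⁻ ζ, b ζ ^ 2) := by
  obtain ⟨M, hM, h⟩ := ball_lintegral (p := 2 * σ) (by linarith)
  refine ⟨M, hM, fun a b ha hb => ?_⟩
  have hk := measurable_kB σ
  have hm : Measurable (fun z : E2 × E2 => (kB σ z.1 z.2 * a z.2) ^ 2) :=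
    (hk.mul (ha.comp measurable_snd)).pow_const 2
  have key : ∀ ξ : E2, (∫⁻ η, kB σ ξ η * (a η * b (ξ - η))) ^ 2 ≤
      (∫⁻ η, (kB σ ξ η * a η) ^ 2) * ∫⁻ ζ, b ζ ^ 2 := by
    intro ξ
    simp_rw [← mul_assoc]
    have h1 : Measurable (fun η => kB σ ξ η) := measurable_kB_right σ ξ
    have h2 : Measurable (fun η => kB σ ξ η * a η) := h1.mul ha
    have h3 : Measurable (fun η => b (ξ - η)) := hb.comp (measurable_const.sub measurable_id)
    refine (cauchy_schwarz h2.aemeasurable h3.aemeasurable).trans ?_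
    rw [lintegral_sub_left_eq_self (fun x => b x ^ 2) ξ]
  refine (lintegral_mono key).trans ?_
  rw [lintegral_mul_const _ (hm.lintegral_prod_right'), ← mul_assoc]
  gcongr
  rw [lintegral_lintegral_swap hm.aemeasurable, ← lintegral_const_mul' _ _ hM]
  refine lintegral_mono_ae ?_
  filter_upwards [ae_ne 0] with η hη
  have hx : 0 < ‖η‖ := norm_pos_iff.2 hη
  calc ∫⁻ ξ, (kB σ ξ η * a η) ^ 2
      = ∫⁻ ξ, (wt (2 * (-σ - 1)) η * a η ^ 2) * (if ‖ξ‖ ≤ ‖η‖ then wt (2 * σ) ξ else 0) := by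
          refine lintegral_congr fun x => ?_
          unfold kB
          split_ifs
          · rw [mul_pow, mul_pow, wt_sq, wt_sq]; ring
          · simp
      _ = (wt (2 * (-σ - 1)) η * a η ^ 2) * ∫⁻ x, (if ‖x‖ ≤ ‖η‖ then wt (2 * σ) x else 0) := by
          rw [lintegral_const_mul]
          exact Measurable.ite (measurableSet_le (by fun_prop) (by fun_prop))
            (measurable_wt _) (by fun_prop)
      _ ≤ (wt (2 * (-σ - 1)) η * a η ^ 2) * (M * wt (2 * σ + 2) η) := by
          gcongr; exact h _ hx
      _ = M * a η ^ 2 * (wt (2 * (-σ - 1)) η * wt (2 * σ + 2) η) := by ring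
      _ = M * a η ^ 2 := by
          rw [wt_mul _ _ hη]
          ring_nf; simp [wt_zero]

lemma rpow_comp {u v : ℝ} (hu : 0 < u) (hv : 0 < v) (h1 : u ≤ 2 * v) (h2 : v ≤ 2 * u) (p : ℝ) :
    u ^ p ≤ 2 ^ |p| * v ^ p := by
  rcases le_total 0 p with hp | hp
  · rw [abs_of_nonneg hp, ← Real.mul_rpow (by norm_num) hv.le]
    exact Real.rpow_le_rpow hu.le h1 hp
  · rw [abs_of_nonpos hp]
    have h3 : (2 * u) ^ p ≤ v ^ p := Real.rpow_le_rpow_of_nonpos hv h2 hp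
    rw [Real.mul_rpow (by norm_num) hu.le] at h3
    calc u ^ p = 2 ^ (-p) * (2 ^ p * u ^ p) := by
          rw [← mul_assoc, ← Real.rpow_add (by norm_num)]; simp
      _ ≤ _ := by gcongr

lemma wt_comp {u v : E2} (hu : u ≠ 0) (hv : v ≠ 0) (h1 : ‖u‖ ≤ 2 * ‖v‖) (h2 : ‖v‖ ≤ 2 * ‖u‖)
    (p : ℝ) : wt p u ≤ ENNReal.ofReal (2 ^ |p|) * wt p v := by
  rw [wt, wt, ← ENNReal.ofReal_mul (by positivity)]
  exact ENNReal.ofReal_le_ofReal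
    (rpow_comp (norm_pos_iff.2 hu) (norm_pos_iff.2 hv) h1 h2 p)

lemma kernel_bound (s₁ s₂ : ℝ) {ξ η : E2} (hξ : ξ ≠ 0) (hη : η ≠ 0) (hζ : ξ - η ≠ 0) :
    wt (s₁ + s₂ - 1) ξ * (wt (-s₁) η * wt (-s₂) (ξ - η)) ≤
      (ENNReal.ofReal (2 ^ |-s₁|) + ENNReal.ofReal (2 ^ |-s₂|)) *
        (kA s₁ ξ η + kA s₂ ξ (ξ - η) + kB (s₁ + s₂ - 1) ξ η) := by
  have t1 : ‖ξ‖ ≤ ‖η‖ + ‖ξ - η‖ := by simpa using norm_add_le η (ξ - η)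
  have t2 : ‖ξ - η‖ ≤ ‖ξ‖ + ‖η‖ := norm_sub_le _ _
  have t3 : ‖η‖ ≤ ‖ξ‖ + ‖ξ - η‖ := by simpa using norm_sub_le ξ (ξ - η)
  by_cases c1 : ‖η‖ ≤ ‖ξ‖ ∧ ‖η‖ ≤ ‖ξ - η‖
  · calc _ ≤ wt (s₁ + s₂ - 1) ξ * (wt (-s₁) η * (ENNReal.ofReal (2 ^ |-s₂|) * wt (-s₂) ξ)) := by
          gcongr
          exact wt_comp hζ hξ (by linarith) (by linarith) _
      _ = ENNReal.ofReal (2 ^ |-s₂|) * ((wt (s₁ + s₂ - 1) ξ * wt (-s₂) ξ) * wt (-s₁) η) := by ring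
      _ = ENNReal.ofReal (2 ^ |-s₂|) * kA s₁ ξ η := by
          rw [wt_mul _ _ hξ, kA, if_pos c1.1]; ring_nf
      _ ≤ _ := by
          gcongr
          · exact le_add_self
          · rw [add_assoc]; exact le_self_add
  by_cases c2 : ‖ξ - η‖ ≤ ‖ξ‖ ∧ ‖ξ - η‖ ≤ ‖η‖
  · calc _ ≤ wt (s₁ + s₂ - 1) ξ * ((ENNReal.ofReal (2 ^ |-s₁|) * wt (-s₁) ξ) * wt (-s₂) (ξ - η)) := by
          gcongr
          exact wt_comp hη hξ (by linarith) (by linarith) _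
      _ = ENNReal.ofReal (2 ^ |-s₁|) * ((wt (s₁ + s₂ - 1) ξ * wt (-s₁) ξ) * wt (-s₂) (ξ - η)) := by ring
      _ = ENNReal.ofReal (2 ^ |-s₁|) * kA s₂ ξ (ξ - η) := by
          rw [wt_mul _ _ hξ, kA, if_pos c2.1]; ring_nf
      _ ≤ _ := by
          gcongr
          · exact le_self_add
          · rw [add_right_comm]; exact le_add_self
  · have c3 : ‖ξ‖ ≤ ‖η‖ ∧ ‖ξ‖ ≤ ‖ξ - η‖ := by
      rcases not_and_or.1 c1 with d1 | d1 <;> rcases not_and_or.1 c2 with d2 | d2 <;>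
        constructor <;> linarith
    calc _ ≤ wt (s₁ + s₂ - 1) ξ * (wt (-s₁) η * (ENNReal.ofReal (2 ^ |-s₂|) * wt (-s₂) η)) := by
          gcongr
          exact wt_comp hζ hη (by linarith) (by linarith) _
      _ = ENNReal.ofReal (2 ^ |-s₂|) * (wt (s₁ + s₂ - 1) ξ * (wt (-s₁) η * wt (-s₂) η)) := by ring
      _ = ENNReal.ofReal (2 ^ |-s₂|) * kB (s₁ + s₂ - 1) ξ η := by
          rw [wt_mul _ _ hη, kB, if_pos c3.1]; ring_nf
      _ ≤ _ := by
          gcongr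
          · exact le_add_self
          · exact le_add_self

lemma sq_add_three (a b c : ℝ≥0∞) : (a + b + c) ^ 2 ≤ 9 * (a ^ 2 + b ^ 2 + c ^ 2) := by
  have key : ∀ m : ℝ≥0∞, a ≤ m → b ≤ m → c ≤ m → (m = a ∨ m = b ∨ m = c) →
      (a + b + c) ^ 2 ≤ 9 * (a ^ 2 + b ^ 2 + c ^ 2) := by
    intro m ha hb hc hm
    calc (a + b + c) ^ 2 ≤ (m + m + m) ^ 2 := by gcongr
      _ = 9 * m ^ 2 := by ring
      _ ≤ _ := by
        gcongr
        rcases hm with rfl | rfl | rfl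
        · rw [add_assoc]; exact le_self_add
        · rw [add_right_comm]; exact le_add_self
        · exact le_add_self
  rcases le_total a b with h1 | h1 <;> rcases le_total b c with h2 | h2 <;>
    rcases le_total a c with h3 | h3
  all_goals first
    | exact key a le_rfl (by assumption) (by assumption) (by simp)
    | exact key b (by assumption) le_rfl (by assumption) (by simp)
    | exact key c (by assumption) (by assumption) le_rfl (by simp)
    | exact key c (h1.trans h2) h2 le_rfl (by simp)
    | exact key a le_rfl h1 (h2.trans h1) (by simp)

theorem core (s₁ s₂ : ℝ) (h₁ : s₁ < 1) (h₂ : s₂ < 1) (h₁₂ : 0 < s₁ + s₂) :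
    ∃ M : ℝ≥0∞, M ≠ ∞ ∧ ∀ F G : E2 → ℝ≥0∞, Measurable F → Measurable G →
      ∫⁻ ξ, (wt (s₁ + s₂ - 1) ξ * ∫⁻ η, F η * G (ξ - η)) ^ 2 ≤
        M * ((∫⁻ η, (wt s₁ η * F η) ^ 2) * ∫⁻ ζ, (wt s₂ ζ * G ζ) ^ 2) := by
  obtain ⟨M₁, hM₁, H₁⟩ := boundA h₁
  obtain ⟨M₂, hM₂, H₂⟩ := boundA h₂
  obtain ⟨M₃, hM₃, H₃⟩ := boundB (σ := s₁ + s₂ - 1) (by linarith)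
  set c := ENNReal.ofReal (2 ^ |-s₁|) + ENNReal.ofReal (2 ^ |-s₂|) with hc
  have hc' : c ≠ ∞ := by simp [hc]
  refine ⟨c ^ 2 * 9 * (M₁ + M₂ + M₃), ?_, fun F G hF hG => ?_⟩
  · refine ENNReal.mul_ne_top (ENNReal.mul_ne_top (ENNReal.pow_ne_top hc') (by norm_num)) ?_
    simp [*]
  set a : E2 → ℝ≥0∞ := fun η => wt s₁ η * F η with ha
  set b : E2 → ℝ≥0∞ := fun η => wt s₂ η * G η with hb
  have ham : Measurable a := (measurable_wt _).mul hF
  have hbm : Measurable b := (measurable_wt _).mul hG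
  have hk₁ := measurable_kA s₁
  have hk₂ := measurable_kA s₂
  have hk₃ := measurable_kB (s₁ + s₂ - 1)
  set J₁ : E2 → ℝ≥0∞ := fun ξ => ∫⁻ η, kA s₁ ξ η * (a η * b (ξ - η)) with hJ₁
  set J₂ : E2 → ℝ≥0∞ := fun ξ => ∫⁻ η, kA s₂ ξ η * (b η * a (ξ - η)) with hJ₂
  set J₃ : E2 → ℝ≥0∞ := fun ξ => ∫⁻ η, kB (s₁ + s₂ - 1) ξ η * (a η * b (ξ - η)) with hJ₃
  have mJ₁ : Measurable J₁ := by
    refine Measurable.lintegral_prod_right'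
      (f := fun z : E2 × E2 => kA s₁ z.1 z.2 * (a z.2 * b (z.1 - z.2)))
      (hk₁.mul ((ham.comp measurable_snd).mul (hbm.comp (measurable_fst.sub measurable_snd))))
  have mJ₂ : Measurable J₂ := by
    refine Measurable.lintegral_prod_right'
      (f := fun z : E2 × E2 => kA s₂ z.1 z.2 * (b z.2 * a (z.1 - z.2)))
      (hk₂.mul ((hbm.comp measurable_snd).mul (ham.comp (measurable_fst.sub measurable_snd))))
  have eJ₂ : ∀ ξ, J₂ ξ = ∫⁻ η, kA s₂ ξ (ξ - η) * (a η * b (ξ - η)) := by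
    intro ξ
    rw [hJ₂]
    simp only
    rw [← lintegral_sub_left_eq_self _ ξ]
    refine lintegral_congr fun η => ?_
    simp [mul_comm (b _)]
  have key : ∀ᵐ ξ : E2, (wt (s₁ + s₂ - 1) ξ * ∫⁻ η, F η * G (ξ - η)) ^ 2 ≤
      c ^ 2 * 9 * (J₁ ξ ^ 2 + J₂ ξ ^ 2 + J₃ ξ ^ 2) := by
    filter_upwards [ae_ne 0] with ξ hξ
    have m₁ : Measurable (fun η => kA s₁ ξ η) := measurable_kA_right s₁ ξ
    have m₂ : Measurable (fun η => kA s₂ ξ (ξ - η)) :=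
      (measurable_kA_right s₂ ξ).comp (measurable_const.sub measurable_id)
    have h : wt (s₁ + s₂ - 1) ξ * ∫⁻ η, F η * G (ξ - η) ≤ c * (J₁ ξ + J₂ ξ + J₃ ξ) := by
      rw [eJ₂, hJ₁, hJ₃]
      simp only
      have mab : Measurable (fun η => a η * b (ξ - η)) :=
        ham.mul (hbm.comp (measurable_const.sub measurable_id))
      have n₁ : Measurable (fun η => kA s₁ ξ η * (a η * b (ξ - η))) := m₁.mul mab
      have n₂ : Measurable (fun η => kA s₁ ξ η * (a η * b (ξ - η)) +
        kA s₂ ξ (ξ - η) * (a η * b (ξ - η))) := n₁.add (m₂.mul mab)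
      rw [← lintegral_add_left n₁, ← lintegral_add_left n₂,
        ← lintegral_const_mul' _ _ hc', ← lintegral_const_mul' _ _ (by simp [wt])]
      refine lintegral_mono_ae ?_
      filter_upwards [ae_ne 0, ae_ne ξ] with η hη hηξ
      have hζ : ξ - η ≠ 0 := sub_ne_zero.2 hηξ.symm
      calc wt (s₁ + s₂ - 1) ξ * (F η * G (ξ - η))
          = wt (s₁ + s₂ - 1) ξ * (((wt (-s₁) η * wt s₁ η) * F η) *
              ((wt (-s₂) (ξ - η) * wt s₂ (ξ - η)) * G (ξ - η))) := by
            rw [wt_cancel _ hη, wt_cancel _ hζ, one_mul, one_mul]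
        _ = (wt (s₁ + s₂ - 1) ξ * (wt (-s₁) η * wt (-s₂) (ξ - η))) * (a η * b (ξ - η)) := by
            simp only [ha, hb]; ring
        _ ≤ (c * (kA s₁ ξ η + kA s₂ ξ (ξ - η) + kB (s₁ + s₂ - 1) ξ η)) * (a η * b (ξ - η)) := by
            exact mul_le_mul_left (kernel_bound s₁ s₂ hξ hη hζ) _
        _ = _ := by ring
    calc _ ≤ (c * (J₁ ξ + J₂ ξ + J₃ ξ)) ^ 2 := by gcongr
      _ = c ^ 2 * (J₁ ξ + J₂ ξ + J₃ ξ) ^ 2 := mul_pow _ _ _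
      _ ≤ c ^ 2 * (9 * (J₁ ξ ^ 2 + J₂ ξ ^ 2 + J₃ ξ ^ 2)) := by gcongr; exact sq_add_three _ _ _
      _ = _ := by ring
  have q₁ : Measurable (fun ξ => J₁ ξ ^ 2) := mJ₁.pow_const 2
  have q₂ : Measurable (fun ξ => J₁ ξ ^ 2 + J₂ ξ ^ 2) := q₁.add (mJ₂.pow_const 2)
  refine (lintegral_mono_ae key).trans ?_
  rw [lintegral_const_mul' _ _ (ENNReal.mul_ne_top (ENNReal.pow_ne_top hc') (by norm_num)),
    lintegral_add_left q₂, lintegral_add_left q₁, mul_assoc (c ^ 2 * 9)]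
  gcongr
  rw [add_mul, add_mul]
  gcongr
  · exact H₁ a b ham hbm
  · rw [mul_comm (∫⁻ η, a η ^ 2)]
    exact H₂ b a hbm ham
  · exact H₃ a b ham hbm

/-- The Fourier transform of a product of Schwartz functions as a convolution. -/
lemma fourier_product (f g : SchwartzMap E2 ℂ) :
    𝓕 (fun x => f x * g x) = ⇑(SchwartzMap.convolution (ContinuousLinearMap.mul ℂ ℂ) (𝓕 f) (𝓕 g)) := by
  ext ξ
  have e : ∀ (h : SchwartzMap E2 ℂ) (x : E2), (𝓕 (𝓕 h)) x = h (-x) := by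
    intro h x
    rw [SchwartzMap.fourier_coe, ← neg_neg x, ← Real.fourierInv_eq_fourier_neg,
      ← SchwartzMap.fourierInv_coe]
    simp
  have h2 : SchwartzMap.convolution (ContinuousLinearMap.mul ℂ ℂ) (𝓕 f) (𝓕 g) =
      𝓕⁻ (SchwartzMap.pairing (ContinuousLinearMap.mul ℂ ℂ) (𝓕 (𝓕 f)) (𝓕 (𝓕 g))) := rfl
  rw [h2, SchwartzMap.fourierInv_coe, Real.fourierInv_eq_fourier_comp_neg]
  refine congrFun (congrArg 𝓕 (funext fun x => ?_)) ξ
  simp [SchwartzMap.pairing_apply_apply, e]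

lemma enorm_fourier_product (f g : SchwartzMap E2 ℂ) (ξ : E2) :
    ‖𝓕 (fun x => f x * g x) ξ‖ₑ ≤ ∫⁻ η, ‖𝓕 (⇑f) η‖ₑ * ‖𝓕 (⇑g) (ξ - η)‖ₑ := by
  rw [fourier_product, SchwartzMap.convolution_apply, MeasureTheory.convolution]
  refine (enorm_integral_le_lintegral_enorm _).trans (lintegral_mono fun η => ?_)
  simp [SchwartzMap.fourier_coe]

lemma sobolev_integrable {s : ℝ} (h : -1 < s) (h' : s < 1) (f : SchwartzMap E2 ℂ) :
    Integrable (fun ξ : E2 => ‖ξ‖ ^ (2 * s) * ‖𝓕 (⇑f) ξ‖ ^ 2) := by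
  rw [← SchwartzMap.fourier_coe]
  generalize 𝓕 f = H
  obtain ⟨C, hC, hb⟩ := H.decay 0 0
  have hb' : ∀ x, ‖H x‖ ≤ C := by simpa using hb
  have i1 := ((ball_real (p := 2 * s) (by linarith) one_pos).1).const_mul (C ^ 2)
  have i2 := (H.integrable_pow_mul volume 2).const_mul C
  refine (i1.add i2).mono' ?_ (ae_of_all _ fun x => ?_)
  · have := H.continuous
    exact ((measurable_norm.pow_const _).mul (by fun_prop)).aestronglyMeasurable
  · rw [Real.norm_of_nonneg (by positivity)]
    by_cases hx : ‖x‖ ≤ 1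
    · simp only [Pi.add_apply, Set.indicator, Set.mem_Iic, hx, if_true]
      have : ‖H x‖ ^ 2 ≤ C ^ 2 := by gcongr; exact hb' x
      calc ‖x‖ ^ (2 * s) * ‖H x‖ ^ 2 ≤ ‖x‖ ^ (2 * s) * C ^ 2 := by gcongr
        _ ≤ C ^ 2 * ‖x‖ ^ (2 * s) + C * (‖x‖ ^ 2 * ‖H x‖) := by
          rw [mul_comm]; exact le_add_of_nonneg_right (by positivity)
    · simp only [Pi.add_apply, Set.indicator, Set.mem_Iic, hx, if_false, mul_zero, zero_add]
      have hx1 : 1 ≤ ‖x‖ := (not_le.1 hx).le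
      calc ‖x‖ ^ (2 * s) * ‖H x‖ ^ 2 ≤ ‖x‖ ^ (2 : ℝ) * (C * ‖H x‖) := by
            rw [pow_two ‖H x‖]
            have e1 : ‖x‖ ^ (2 * s) ≤ ‖x‖ ^ (2 : ℝ) :=
              Real.rpow_le_rpow_of_exponent_le hx1 (by linarith)
            have e2 := hb' x
            gcongr
        _ = _ := by rw [Real.rpow_two]; ring

lemma ofReal_eq (s : ℝ) (u : E2 → ℂ) (ξ : E2) :
    ENNReal.ofReal (‖ξ‖ ^ (2 * s) * ‖u ξ‖ ^ 2) = (wt s ξ * ‖u ξ‖ₑ) ^ 2 := by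
  rw [mul_pow, wt_sq, wt, ENNReal.ofReal_mul (by positivity), ENNReal.ofReal_pow (norm_nonneg _),
    ofReal_norm]

lemma norm_sq_eq (s : ℝ) (f : E2 → ℂ)
    (hi : Integrable (fun ξ : E2 => ‖ξ‖ ^ (2 * s) * ‖𝓕 f ξ‖ ^ 2)) :
    ENNReal.ofReal (∫ ξ : E2, ‖ξ‖ ^ (2 * s) * ‖𝓕 f ξ‖ ^ 2) = ∫⁻ ξ, (wt s ξ * ‖𝓕 f ξ‖ₑ) ^ 2 := by
  rw [ofReal_integral_eq_lintegral_ofReal hi (ae_of_all _ fun x => by positivity)]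
  exact lintegral_congr fun ξ => ofReal_eq s _ ξ

end ProductLaw

open ProductLaw

/-- Product law in homogeneous Sobolev spaces on `ℝ²`: for `s₁, s₂ < 1` with
`s₁ + s₂ > 0` there is `C = C(s₁,s₂) > 0` such that for all (Schwartz) `f, g`,
`fg ∈ Ḣ^{s₁+s₂−1}` and `‖fg‖_{Ḣ^{s₁+s₂−1}} ≤ C ‖f‖_{Ḣ^{s₁}} ‖g‖_{Ḣ^{s₂}}`. -/
theorem stmt_16 (s₁ s₂ : ℝ) (h₁ : s₁ < 1) (h₂ : s₂ < 1) (h₁₂ : 0 < s₁ + s₂) :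
    ∃ C : ℝ, 0 < C ∧
      ∀ f g : SchwartzMap (EuclideanSpace ℝ (Fin 2)) ℂ,
        Integrable (fun ξ : EuclideanSpace ℝ (Fin 2) =>
          ‖ξ‖ ^ (2 * (s₁ + s₂ - 1)) * ‖𝓕 (fun x => f x * g x) ξ‖ ^ 2) volume ∧
        homSobolevNorm (s₁ + s₂ - 1) (fun x => f x * g x) ≤
          C * homSobolevNorm s₁ (⇑f) * homSobolevNorm s₂ (⇑g) := by
  obtain ⟨M, hM, H⟩ := core s₁ s₂ h₁ h₂ h₁₂
  refine ⟨(M.toReal + 1) ^ (1 / 2 : ℝ), by positivity, fun f g => ?_⟩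
  have if₁ := sobolev_integrable (s := s₁) (by linarith) h₁ f
  have if₂ := sobolev_integrable (s := s₂) (by linarith) h₂ g
  have cf : Continuous (𝓕 (⇑f)) := by
    rw [← SchwartzMap.fourier_coe]; exact (𝓕 f).continuous
  have cg : Continuous (𝓕 (⇑g)) := by
    rw [← SchwartzMap.fourier_coe]; exact (𝓕 g).continuous
  have cfg : Continuous (𝓕 (fun x => f x * g x)) := by
    rw [fourier_product]; exact SchwartzMap.continuous _
  set A := ∫ ξ : E2, ‖ξ‖ ^ (2 * s₁) * ‖𝓕 (⇑f) ξ‖ ^ 2 with hA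
  set B := ∫ ξ : E2, ‖ξ‖ ^ (2 * s₂) * ‖𝓕 (⇑g) ξ‖ ^ 2 with hB
  have hA0 : 0 ≤ A := integral_nonneg fun x => by positivity
  have hB0 : 0 ≤ B := integral_nonneg fun x => by positivity
  have bound : ∫⁻ ξ, (wt (s₁ + s₂ - 1) ξ * ‖𝓕 (fun x => f x * g x) ξ‖ₑ) ^ 2 ≤
      ENNReal.ofReal (M.toReal * (A * B)) := by
    rw [ENNReal.ofReal_mul (by positivity), ENNReal.ofReal_toReal hM, ENNReal.ofReal_mul hA0,
      norm_sq_eq s₁ _ if₁, norm_sq_eq s₂ _ if₂]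
    refine le_trans (lintegral_mono fun ξ => ?_)
      (H (fun η => ‖𝓕 (⇑f) η‖ₑ) (fun η => ‖𝓕 (⇑g) η‖ₑ) cf.measurable.enorm cg.measurable.enorm)
    gcongr
    exact enorm_fourier_product f g ξ
  have hI : Integrable (fun ξ : E2 =>
      ‖ξ‖ ^ (2 * (s₁ + s₂ - 1)) * ‖𝓕 (fun x => f x * g x) ξ‖ ^ 2) volume := by
    refine ⟨((measurable_norm.pow_const _).mul
      (cfg.measurable.norm.pow_const 2)).aestronglyMeasurable, ?_⟩
    rw [hasFiniteIntegral_iff_ofReal (ae_of_all _ fun x => by positivity)]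
    simp_rw [ofReal_eq]
    exact bound.trans_lt ENNReal.ofReal_lt_top
  refine ⟨hI, ?_⟩
  rw [← norm_sq_eq _ _ hI, ENNReal.ofReal_le_ofReal_iff (by positivity)] at bound
  unfold homSobolevNorm
  rw [← hA, ← hB, ← Real.mul_rpow (by positivity) hA0, ← Real.mul_rpow (by positivity) hB0]
  refine Real.rpow_le_rpow (integral_nonneg fun x => by positivity) (bound.trans ?_) (by norm_num)
  have := mul_nonneg hA0 hB0
  nlinarith
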